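/- Let I₀(x) = Σ_{m=0}^∞ x^{2m}/(2^{2m}(m!)²) be the modified Bessel function of order zero and I₀' its derivative. For every α > 0 there exists exactly one t_α ∈ (0,∞) such that I₀(t_α) − α·t_α·I₀'(t_α) = 0. Moreover, α ↦ t_α is strictly decreasing: if 0 < α₁ < α₂ then t_{α₂} < t_{α₁}. -/

import Mathlib

noncomputable section

/-- The modified Bessel function of order zero `I₀(x) = Σ x^{2m} / (2^{2m} (m!)²)`. -/
def I0 (x : ℝ) : ℝ :=
  ∑' m : ℕ, x ^ (2 * m) / (2 ^ (2 * m) * (Nat.factorial m : ℝ) ^ 2)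

/-- Termwise differentiation of an even power series whose coefficients are `O(1 / m!)`. -/
lemma hasDerivAt_tsum_even {c : ℕ → ℝ} {K : ℝ} (hc : ∀ m, |c m| ≤ K / (Nat.factorial m : ℝ))
    (x : ℝ) :
    HasDerivAt (fun y : ℝ => ∑' m : ℕ, c m * y ^ (2 * m))
      (∑' m : ℕ, c m * ((2 * m : ℕ) * x ^ (2 * m - 1))) x := by
  set R : ℝ := |x| + 1 with hR
  have hR0 : 0 < R := by positivity
  have hu : Summable fun m : ℕ =>
      K / (Nat.factorial m : ℝ) * ((2 * m : ℕ) * R ^ (2 * m - 1)) := by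
    rw [← summable_nat_add_iff 1]
    refine ((Real.summable_pow_div_factorial (R ^ 2)).mul_left (2 * K * R)).congr fun m => ?_
    rw [show 2 * (m + 1) - 1 = 2 * m + 1 by omega, Nat.factorial_succ,
      pow_succ R (2 * m), pow_mul]
    have : (Nat.factorial m : ℝ) ≠ 0 := by positivity
    push_cast
    field_simp
  refine hasDerivAt_tsum_of_isPreconnected (t := Metric.ball 0 R) (y₀ := 0) hu
    Metric.isOpen_ball (convex_ball _ _).isPreconnected
    (g := fun m y => c m * y ^ (2 * m))
    (g' := fun m y => c m * ((2 * m : ℕ) * y ^ (2 * m - 1))) ?_ ?_ ?_ ?_ ?_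
  · intro m y _
    exact (hasDerivAt_pow (2 * m) y).const_mul (c m)
  · intro m y hy
    have hy' : |y| ≤ R := by simpa using (Metric.mem_ball.1 hy).le
    rw [Real.norm_eq_abs, abs_mul, abs_mul, abs_pow, Nat.abs_cast]
    have := hc m
    gcongr
    exact (abs_nonneg _).trans this
  · simpa using hR0
  · refine summable_of_ne_finset_zero (s := {0}) fun m hm => ?_
    have : m ≠ 0 := by simpa using hm
    simp [this]
  · simp [hR]

/-- The coefficient of `x ^ (2 * m)` in `I0 x`. -/
def I0Coeff (m : ℕ) : ℝ := 1 / (2 ^ (2 * m) * (Nat.factorial m : ℝ) ^ 2)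

lemma I0Coeff_nonneg (m : ℕ) : 0 ≤ I0Coeff m := by unfold I0Coeff; positivity

lemma I0Coeff_succ (m : ℕ) : (2 * (m + 1 : ℝ)) ^ 2 * I0Coeff (m + 1) = I0Coeff m := by
  unfold I0Coeff
  rw [Nat.factorial_succ]
  have : (Nat.factorial m : ℝ) ≠ 0 := by positivity
  push_cast
  field_simp
  ring

lemma two_mul_mul_I0Coeff_le (m : ℕ) : 2 * m * I0Coeff m ≤ 1 / (Nat.factorial m : ℝ) := by
  have h2 : (2 * m : ℝ) ≤ 2 ^ (2 * m) := by exact_mod_cast (Nat.lt_two_pow_self (n := 2 * m)).le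
  have h1 : (1 : ℝ) ≤ Nat.factorial m := by exact_mod_cast m.factorial_pos
  unfold I0Coeff
  rw [mul_one_div, div_le_div_iff₀ (by positivity) (by positivity), one_mul, sq]
  gcongr
  exact le_mul_of_one_le_left (by positivity) h1

lemma I0Coeff_le (m : ℕ) : I0Coeff m ≤ 1 / (Nat.factorial m : ℝ) := by
  have h2 : (1 : ℝ) ≤ 2 ^ (2 * m) := one_le_pow₀ (by norm_num)
  have h1 : (1 : ℝ) ≤ Nat.factorial m := by exact_mod_cast m.factorial_pos
  unfold I0Coeff
  gcongr
  nlinarith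

lemma I0_eq_tsum (x : ℝ) : I0 x = ∑' m : ℕ, I0Coeff m * x ^ (2 * m) := by
  refine tsum_congr fun m => ?_
  rw [I0Coeff, one_div_mul_eq_div]

lemma hasDerivAt_I0 (x : ℝ) :
    HasDerivAt I0 (∑' m : ℕ, I0Coeff m * ((2 * m : ℕ) * x ^ (2 * m - 1))) x := by
  rw [funext I0_eq_tsum]
  refine hasDerivAt_tsum_even (K := 1) (fun m => ?_) x
  rw [abs_of_nonneg (I0Coeff_nonneg m)]
  exact I0Coeff_le m

lemma one_le_I0 (x : ℝ) : 1 ≤ I0 x := by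
  have hs : Summable fun m : ℕ => I0Coeff m * x ^ (2 * m) := by
    refine Summable.of_nonneg_of_le
      (fun m => mul_nonneg (I0Coeff_nonneg m) (by rw [pow_mul]; positivity)) (fun m => ?_)
      (Real.summable_pow_div_factorial (x ^ 2))
    rw [← pow_mul, ← one_div_mul_eq_div]
    have : 0 ≤ x ^ (2 * m) := by rw [pow_mul]; positivity
    gcongr
    exact I0Coeff_le m
  have h := hs.le_tsum 0 fun m _ => mul_nonneg (I0Coeff_nonneg m) (by rw [pow_mul]; positivity)
  rw [I0_eq_tsum]
  simpa [I0Coeff] using h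

lemma mul_deriv_I0 (x : ℝ) :
    x * deriv I0 x = ∑' m : ℕ, 2 * m * I0Coeff m * x ^ (2 * m) := by
  rw [(hasDerivAt_I0 x).deriv, ← tsum_mul_left]
  refine tsum_congr fun m => ?_
  rcases m with _ | m
  · simp
  · rw [show 2 * (m + 1) - 1 = 2 * m + 1 by omega]
    push_cast
    ring

/-- Bessel's equation `(x I₀')' = x I₀`. -/
lemma hasDerivAt_mul_deriv_I0 (x : ℝ) :
    HasDerivAt (fun y => y * deriv I0 y) (x * I0 x) x := by
  rw [funext mul_deriv_I0]
  convert hasDerivAt_tsum_even (c := fun m => 2 * m * I0Coeff m) (K := 1) (fun m => ?_) x using 1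
  · have h0 : ∀ m : ℕ, m ∉ Set.range Nat.succ →
        2 * m * I0Coeff m * ((2 * m : ℕ) * x ^ (2 * m - 1)) = 0 := by
      intro m hm
      rcases m with _ | m
      · simp
      · exact absurd ⟨m, rfl⟩ hm
    rw [I0_eq_tsum, ← tsum_mul_left,
      ← Nat.succ_injective.tsum_eq (Function.support_subset_iff'.2 h0)]
    refine tsum_congr fun m => ?_
    rw [← I0Coeff_succ, show 2 * m.succ - 1 = 2 * m + 1 by omega]
    push_cast
    ring
  · rw [abs_of_nonneg (mul_nonneg (by positivity) (I0Coeff_nonneg m))]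
    exact two_mul_mul_I0Coeff_le m

/-- The derivative `x I₀'(x) / I₀(x)` of `log (I₀ x)` with respect to `log x`. -/
def I0LogDeriv (x : ℝ) : ℝ := x * deriv I0 x / I0 x

lemma hasDerivAt_I0LogDeriv (x : ℝ) :
    HasDerivAt I0LogDeriv (x - x * (deriv I0 x / I0 x) ^ 2) x := by
  have h0 : I0 x ≠ 0 := (zero_lt_one.trans_le (one_le_I0 x)).ne'
  have hd := (hasDerivAt_I0 x).differentiableAt.hasDerivAt
  refine ((hasDerivAt_mul_deriv_I0 x).fun_div hd h0).congr_deriv ?_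
  field_simp

lemma continuous_I0LogDeriv : Continuous I0LogDeriv :=
  continuous_iff_continuousAt.2 fun x => (hasDerivAt_I0LogDeriv x).continuousAt

lemma sq_mul_deriv_I0_lt {x : ℝ} (hx : 0 < x) : (x * deriv I0 x) ^ 2 < (x * I0 x) ^ 2 := by
  have hV : ∀ y, HasDerivAt (fun y => (y * I0 y) ^ 2 - (y * deriv I0 y) ^ 2)
      (2 * y * I0 y ^ 2) y := by
    intro y
    have hd := (hasDerivAt_I0 y).differentiableAt.hasDerivAt
    refine ((((hasDerivAt_id' y).fun_mul hd).fun_pow 2).fun_sub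
      ((hasDerivAt_mul_deriv_I0 y).fun_pow 2)).congr_deriv ?_
    simp only [Nat.cast_ofNat, Nat.add_one_sub_one, pow_one]
    ring
  have hmono : StrictMonoOn (fun y => (y * I0 y) ^ 2 - (y * deriv I0 y) ^ 2) (Set.Ici 0) := by
    refine strictMonoOn_of_deriv_pos (convex_Ici 0)
      (fun y _ => (hV y).continuousAt.continuousWithinAt) fun y hy => ?_
    rw [interior_Ici] at hy
    rw [(hV y).deriv]
    have := zero_lt_one.trans_le (one_le_I0 y)
    have : 0 < y := hy
    positivity
  have h := hmono Set.self_mem_Ici (Set.mem_Ici.2 hx.le) hx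
  simpa using h

lemma strictMonoOn_I0LogDeriv : StrictMonoOn I0LogDeriv (Set.Ici 0) := by
  refine strictMonoOn_of_deriv_pos (convex_Ici 0) continuous_I0LogDeriv.continuousOn
    fun x hx => ?_
  rw [interior_Ici] at hx
  have hx : 0 < x := hx
  have hI := zero_lt_one.trans_le (one_le_I0 x)
  have hlt : deriv I0 x ^ 2 < I0 x ^ 2 := by
    have h := sq_mul_deriv_I0_lt hx
    rw [mul_pow, mul_pow] at h
    exact lt_of_mul_lt_mul_left h (by positivity)
  have hlt1 : (deriv I0 x / I0 x) ^ 2 < 1 := by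
    rw [div_pow, div_lt_one (by positivity)]
    exact hlt
  rw [(hasDerivAt_I0LogDeriv x).deriv]
  nlinarith

lemma I0LogDeriv_zero : I0LogDeriv 0 = 0 := by simp [I0LogDeriv]

lemma exists_le_I0LogDeriv {C : ℝ} (hC : 0 < C) : ∃ t, 0 ≤ t ∧ C ≤ I0LogDeriv t := by
  by_contra! hlt
  have hmono : MonotoneOn (fun t => I0LogDeriv t - t) (Set.Ici (C + 1)) := by
    have hd : ∀ t, HasDerivAt (fun t => I0LogDeriv t - t)
        (t - t * (deriv I0 t / I0 t) ^ 2 - 1) t :=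
      fun t => (hasDerivAt_I0LogDeriv t).sub (hasDerivAt_id t)
    refine monotoneOn_of_deriv_nonneg (convex_Ici _)
      (fun t _ => (hd t).continuousAt.continuousWithinAt)
      (fun t _ => (hd t).differentiableAt.differentiableWithinAt) fun t ht => ?_
    rw [interior_Ici] at ht
    have ht : C + 1 < t := ht
    have ht0 : 0 < t := by linarith
    have h1 := hlt t ht0.le
    have h2 : 0 < I0LogDeriv t := by
      rw [← I0LogDeriv_zero]
      exact strictMonoOn_I0LogDeriv Set.self_mem_Ici (Set.mem_Ici.2 ht0.le) ht0
    rw [(hd t).deriv]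
    have h3 : t * (t * (deriv I0 t / I0 t) ^ 2) = I0LogDeriv t ^ 2 := by
      rw [I0LogDeriv]; ring
    refine nonneg_of_mul_nonneg_right (a := t) ?_ ht0
    nlinarith
  have h := hmono (Set.mem_Ici.2 le_rfl) (Set.mem_Ici.2 (by linarith : C + 1 ≤ 2 * C + 2))
    (by linarith)
  have h0 := strictMonoOn_I0LogDeriv Set.self_mem_Ici
    (Set.mem_Ici.2 (by linarith : 0 ≤ C + 1)) (by linarith : 0 < C + 1)
  rw [I0LogDeriv_zero] at h0
  have h1 := hlt (2 * C + 2) (by linarith)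
  simp only at h
  linarith

lemma I0_sub_eq_zero_iff {α : ℝ} (hα : 0 < α) (t : ℝ) :
    I0 t - α * (t * deriv I0 t) = 0 ↔ I0LogDeriv t = α⁻¹ := by
  have h0 : I0 t ≠ 0 := (zero_lt_one.trans_le (one_le_I0 t)).ne'
  rw [I0LogDeriv, div_eq_iff h0, eq_inv_mul_iff_mul_eq₀ hα.ne', sub_eq_zero, eq_comm]

/-- for each `α > 0`, the function `t ↦ I₀(t) − α t I₀'(t)` has a unique
zero `t_α` in `(0,∞)`, and `α ↦ t_α` is strictly decreasing. -/
theorem I0_unique_zero :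
    (∀ α : ℝ, 0 < α → ∃! t : ℝ, 0 < t ∧ I0 t - α * (t * deriv I0 t) = 0)
    ∧ (∀ α₁ α₂ t₁ t₂ : ℝ, 0 < α₁ → α₁ < α₂ →
        0 < t₁ → I0 t₁ - α₁ * (t₁ * deriv I0 t₁) = 0 →
        0 < t₂ → I0 t₂ - α₂ * (t₂ * deriv I0 t₂) = 0 →
        t₂ < t₁) := by
  constructor
  · intro α hα
    obtain ⟨T, hT, hCT⟩ := exists_le_I0LogDeriv (inv_pos.2 hα)
    obtain ⟨t, ht, hteq⟩ := intermediate_value_Icc hT continuous_I0LogDeriv.continuousOn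
      (show α⁻¹ ∈ Set.Icc (I0LogDeriv 0) (I0LogDeriv T) from
        ⟨I0LogDeriv_zero.trans_le (inv_pos.2 hα).le, hCT⟩)
    have ht0 : t ≠ 0 := by
      rintro rfl
      rw [I0LogDeriv_zero] at hteq
      exact (inv_pos.2 hα).ne hteq
    refine ⟨t, ⟨lt_of_le_of_ne ht.1 ht0.symm, (I0_sub_eq_zero_iff hα t).2 hteq⟩, ?_⟩
    rintro s ⟨hs, hseq⟩
    refine strictMonoOn_I0LogDeriv.injOn (Set.mem_Ici.2 hs.le) ht.1 ?_
    rw [hteq, (I0_sub_eq_zero_iff hα s).1 hseq]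
  · intro α₁ α₂ t₁ t₂ hα₁ hα ht₁ h₁ ht₂ h₂
    rw [← strictMonoOn_I0LogDeriv.lt_iff_lt (Set.mem_Ici.2 ht₂.le) (Set.mem_Ici.2 ht₁.le),
      (I0_sub_eq_zero_iff hα₁ t₁).1 h₁, (I0_sub_eq_zero_iff (hα₁.trans hα) t₂).1 h₂]
    exact inv_strictAnti₀ hα₁ hα
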